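/- There exist constants c > 0 and c' > 0 such that the following holds. Let G₀ be a connected simple graph on n ≥ 2 vertices whose edge set has k ≥ 2 fewer edges than the complete graph on the same vertex set. Then the probability that the triangulation process started at G₀ reaches the complete graph within ⌊c·n·ln k⌋ rounds is at most c'·e^{−k^{1/4}}. -/

import Mathlib

open scoped Classical

noncomputable section

variable {V : Type} [Fintype V] [DecidableEq V]

/-- The neighbors of `v` in `G`, as a `Finset`. -/
def nbr (G : SimpleGraph V) (v : V) : Finset V := Finset.univ.filter (fun w => G.Adj v w)

/-- The degree `d(v)` of `v` in `G`. -/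
def deg (G : SimpleGraph V) (v : V) : ℕ := (nbr G v).card

/-- The minimum degree of `G`. -/
def minDeg (G : SimpleGraph V) : ℕ := sInf (Set.range (deg G))

/-- `Nk G u i` is the set `Nⁱ(u)` of vertices at graph distance exactly `i` from `u`. -/
def Nk (G : SimpleGraph V) (u : V) (i : ℕ) : Finset V :=
  Finset.univ.filter (fun v => v ≠ u ∧ G.dist u v = i)

/-- `degIn G v S` is `d(v, S)`, the number of neighbors of `v` lying in `S`. -/
def degIn (G : SimpleGraph V) (v : V) (S : Finset V) : ℕ := (nbr G v ∩ S).card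

/-- The graph obtained from a choice function `c` in one round of the triangulation
process: every vertex `w` adds the edge joining the ordered pair `c w` of its chosen
neighbors (edges are unordered, loops are discarded, all additions are simultaneous). -/
def triNext (G : SimpleGraph V) (c : V → V × V) : SimpleGraph V :=
  G ⊔ SimpleGraph.fromEdgeSet {e | ∃ v : V, e = s((c v).1, (c v).2)}

/-- The probability that in one round of the triangulation process on the current
graph `G` the vertices make exactly the choices recorded by `c`: each vertex with at
least one neighbor independently picks an ordered pair of its neighbors uniformly at
random with replacement; isolated vertices are given the dummy choice `(v, v)`. -/
def triWeight (G : SimpleGraph V) (c : V → V × V) : ℝ :=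
  ∏ v : V,
    if deg G v = 0 then (if c v = (v, v) then 1 else 0)
    else if (c v).1 ∈ nbr G v ∧ (c v).2 ∈ nbr G v then (1 : ℝ) / (deg G v : ℝ) ^ 2 else 0

/-- Transition probability of one round of the triangulation process. -/
def triStep (G G' : SimpleGraph V) : ℝ :=
  ∑ c : V → V × V, if triNext G c = G' then triWeight G c else 0

/-- The graph obtained from a choice function `c` in one round of the two-hop walk
process: every vertex `u` adds the edge to the endpoint `(c u).2` of its two-hop walk
(loops are discarded, all additions are simultaneous). -/
def hopNext (G : SimpleGraph V) (c : V → V × V) : SimpleGraph V :=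
  G ⊔ SimpleGraph.fromEdgeSet {e | ∃ u : V, e = s(u, (c u).2)}

/-- The probability that in one round of the two-hop walk process on the current graph
`G` the vertices make exactly the choices recorded by `c`: each vertex `u` with at
least one neighbor independently picks a uniformly random neighbor `v = (c u).1` and
then a uniformly random neighbor `w = (c u).2` of `v`; isolated vertices are given the
dummy choice `(u, u)`. -/
def hopWeight (G : SimpleGraph V) (c : V → V × V) : ℝ :=
  ∏ u : V,
    if deg G u = 0 then (if c u = (u, u) then 1 else 0)
    else if (c u).1 ∈ nbr G u ∧ (c u).2 ∈ nbr G (c u).1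
      then (1 : ℝ) / ((deg G u : ℝ) * (deg G (c u).1 : ℝ)) else 0

/-- Transition probability of one round of the two-hop walk process. -/
def hopStep (G G' : SimpleGraph V) : ℝ :=
  ∑ c : V → V × V, if hopNext G c = G' then hopWeight G c else 0

/-- `trajProb step g0 T E` is the probability, for the Markov chain on a finite state
space `Γ` with one-step transition probabilities `step` started at `g0`, that the
trajectory `(g_0, g_1, …, g_T)` satisfies the event `E`; probabilities are realized as
a probability mass function on finite sequences of states.  (The trajectory is passed
to `E` as a function on `ℕ`, frozen at time `T`.) -/
def trajProb {Γ : Type} [Fintype Γ] (step : Γ → Γ → ℝ) (g0 : Γ) (T : ℕ)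
    (E : (ℕ → Γ) → Prop) : ℝ :=
  ∑ s : Fin (T + 1) → Γ,
    if s 0 = g0 ∧ E (fun t => s ⟨min t T, Nat.lt_succ_of_le (Nat.min_le_right t T)⟩)
    then ∏ t : Fin T, step (s t.castSucc) (s t.succ) else 0

end

section TrajectoryBounds

open Finset

/-- A family `Φ` dominating the indicator of `z` and satisfying a one-step supermartingale
inequality dominates the probability of being at `z` at time `T`. -/
lemma sum_traj_le_of_supermartingale {Γ : Type} [Fintype Γ] (step : Γ → Γ → ℝ) (z : Γ)
    (hstep : ∀ a b, 0 ≤ step a b) (Φ : ℕ → Γ → ℝ) (hnn : ∀ g, 0 ≤ Φ 0 g) (hz : 1 ≤ Φ 0 z)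
    (hΦ : ∀ r g, ∑ g', step g g' * Φ r g' ≤ Φ (r + 1) g) (T : ℕ) (g0 : Γ) :
    (∑ s : Fin (T + 1) → Γ, if s 0 = g0 ∧ s (Fin.last T) = z
      then ∏ t : Fin T, step (s t.castSucc) (s t.succ) else 0) ≤ Φ T g0 := by
  induction T generalizing g0 with
  | zero =>
    rw [← (Equiv.funUnique (Fin 1) Γ).symm.sum_comp]
    simp only [Equiv.funUnique_symm_apply, uniqueElim_const, Fin.prod_univ_zero]
    by_cases h : g0 = z
    · subst h
      simpa [Finset.sum_ite_eq] using hz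
    · rw [Finset.sum_eq_zero]
      · exact hnn g0
      · intro x _
        rw [if_neg]
        rintro ⟨h1, h2⟩
        exact h (h1.symm.trans h2)
  | succ T ih =>
    refine le_trans (le_of_eq ?_)
      ((Finset.sum_le_sum fun g' _ => mul_le_mul_of_nonneg_left (ih g') (hstep g0 g')).trans
        (hΦ T g0))
    rw [← (Fin.consEquiv (fun _ : Fin (T + 2) => Γ)).sum_comp, Fintype.sum_prod_type,
      Finset.sum_eq_single g0]
    · simp only [Finset.mul_sum]
      rw [Finset.sum_comm]
      refine Finset.sum_congr rfl fun s _ => ?_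
      rw [Finset.sum_eq_single (s 0)]
      · have hl : Fin.last (T + 1) = (Fin.last T).succ := rfl
        simp only [Fin.consEquiv_apply, Fin.cons_zero, hl, Fin.cons_succ, true_and,
          Fin.prod_univ_succ, Fin.castSucc_zero, ← Fin.succ_castSucc, mul_ite, mul_zero]
      · intro b _ hb
        rw [if_neg (fun h => hb h.1.symm), mul_zero]
      · simp
    · intro b _ hb
      refine Finset.sum_eq_zero fun s _ => ?_
      rw [if_neg]
      simp [Fin.consEquiv_apply, hb]
    · simp

/-- For a chain that only moves upwards, hitting the top by time `T` amounts to being there at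
time `T`. -/
lemma trajProb_hit_top_le {Γ : Type} [Fintype Γ] [PartialOrder Γ] [OrderTop Γ]
    (step : Γ → Γ → ℝ) (hstep : ∀ a b, 0 ≤ step a b) (hmono : ∀ a b, step a b ≠ 0 → a ≤ b)
    (g0 : Γ) (T : ℕ) :
    trajProb step g0 T (fun g => ∃ t ≤ T, g t = ⊤) ≤
      ∑ s : Fin (T + 1) → Γ, if s 0 = g0 ∧ s (Fin.last T) = ⊤
        then ∏ t : Fin T, step (s t.castSucc) (s t.succ) else 0 := by
  unfold trajProb
  refine Finset.sum_le_sum fun s _ => ?_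
  have hnn : 0 ≤ ∏ t : Fin T, step (s t.castSucc) (s t.succ) :=
    Finset.prod_nonneg fun t _ => hstep _ _
  split_ifs with h1 h2 h2
  · exact le_rfl
  · by_contra! hpos
    have hs : Monotone s := Fin.monotone_iff_le_succ.2 fun t =>
      hmono _ _ fun h0 => hpos.ne' (Finset.prod_eq_zero (mem_univ t) h0)
    obtain ⟨h10, t, -, ht⟩ := h1
    exact h2 ⟨h10, top_le_iff.1 (ht ▸ hs (Fin.le_last _))⟩
  · exact hnn
  · exact le_rfl

end TrajectoryBounds

section Triangulation

open Finset

variable {V : Type} [Fintype V] [DecidableEq V]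

/-- The ordered pairs of distinct non-adjacent vertices. -/
noncomputable def missingPairs (G : SimpleGraph V) : Finset (V × V) :=
  Finset.univ.filter fun p => p.1 ≠ p.2 ∧ ¬ G.Adj p.1 p.2

/-- The probability that `v` selects the ordered pair `p` in one round. -/
noncomputable def choiceWeight (G : SimpleGraph V) (v : V) (p : V × V) : ℝ :=
  if deg G v = 0 then (if p = (v, v) then 1 else 0)
    else if p.1 ∈ nbr G v ∧ p.2 ∈ nbr G v then (1 : ℝ) / (deg G v : ℝ) ^ 2 else 0

lemma triWeight_eq_prod (G : SimpleGraph V) (c : V → V × V) :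
    triWeight G c = ∏ v, choiceWeight G v (c v) := rfl

lemma choiceWeight_nonneg (G : SimpleGraph V) (v : V) (p : V × V) : 0 ≤ choiceWeight G v p := by
  unfold choiceWeight
  split_ifs <;> positivity

lemma triWeight_nonneg (G : SimpleGraph V) (c : V → V × V) : 0 ≤ triWeight G c :=
  Finset.prod_nonneg fun v _ => choiceWeight_nonneg G v (c v)

lemma triStep_nonneg (G G' : SimpleGraph V) : 0 ≤ triStep G G' := by
  refine Finset.sum_nonneg fun c _ => ?_
  split_ifs
  · exact triWeight_nonneg G c
  · exact le_rfl

lemma le_of_triStep_ne_zero (G G' : SimpleGraph V) (h : triStep G G' ≠ 0) : G ≤ G' := by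
  obtain ⟨c, -, hc⟩ := Finset.exists_ne_zero_of_sum_ne_zero h
  have : triNext G c = G' := by
    by_contra h'
    exact hc (if_neg h')
  exact this ▸ le_sup_left

lemma sum_triStep_mul (G : SimpleGraph V) (F : SimpleGraph V → ℝ) :
    ∑ G', triStep G G' * F G' = ∑ c : V → V × V, triWeight G c * F (triNext G c) := by
  simp only [triStep, Finset.sum_mul]
  rw [Finset.sum_comm]
  refine Finset.sum_congr rfl fun c _ => ?_
  simp [ite_mul]

lemma sum_triWeight_mul_prod (G : SimpleGraph V) (h : V → V × V → ℝ) :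
    ∑ c : V → V × V, triWeight G c * ∏ v, h v (c v) =
      ∏ v, ∑ p, choiceWeight G v p * h v p := by
  rw [Finset.prod_univ_sum, Fintype.piFinset_univ]
  simp only [triWeight_eq_prod, Finset.prod_mul_distrib]

lemma filter_mem_nbr_prod (G : SimpleGraph V) (v : V) :
    (Finset.univ.filter fun p : V × V => p.1 ∈ nbr G v ∧ p.2 ∈ nbr G v) =
      nbr G v ×ˢ nbr G v := by
  ext p
  simp

lemma sum_choiceWeight (G : SimpleGraph V) (v : V) : ∑ p, choiceWeight G v p = 1 := by
  unfold choiceWeight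
  split_ifs with h
  · simp
  · rw [← Finset.sum_filter, filter_mem_nbr_prod, Finset.sum_const, Finset.card_product]
    change (deg G v * deg G v) • _ = (1 : ℝ)
    have : (deg G v : ℝ) ≠ 0 := by exact_mod_cast h
    simp only [nsmul_eq_mul, Nat.cast_mul]
    field_simp

lemma sum_triWeight (G : SimpleGraph V) : ∑ c, triWeight G c = 1 := by
  simpa [sum_choiceWeight] using sum_triWeight_mul_prod G fun _ _ => 1

/-- In one round a degree can at most double. -/
lemma deg_triNext_le (G : SimpleGraph V) (c : V → V × V) (hc : triWeight G c ≠ 0) (u : V) :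
    deg (triNext G c) u ≤ 2 * deg G u := by
  have hsub : nbr (triNext G c) u ⊆
      nbr G u ∪ (nbr G u).image fun v => if (c v).1 = u then (c v).2 else (c v).1 := by
    intro x hx
    simp only [nbr, mem_filter, mem_univ, true_and, triNext, SimpleGraph.sup_adj,
      SimpleGraph.fromEdgeSet_adj, Set.mem_ofPred_eq, mem_union, mem_image] at hx ⊢
    rcases hx with hx | ⟨⟨v, hv⟩, hne⟩
    · exact Or.inl hx
    · right
      have hw : choiceWeight G v (c v) ≠ 0 := fun h0 =>
        hc (Finset.prod_eq_zero (mem_univ v) h0)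
      rcases hcv : c v with ⟨a, b⟩
      rw [hcv] at hv hw
      simp only [choiceWeight, nbr, mem_filter, mem_univ, true_and, Prod.mk.injEq] at hw
      rw [Sym2.eq_iff] at hv
      refine ⟨v, ?_, ?_⟩
      · split_ifs at hw with h1 h2 h3
        · exact absurd (by grind) hne
        · exact absurd rfl hw
        · rcases hv with ⟨rfl, rfl⟩ | ⟨rfl, rfl⟩
          · exact h3.1.symm
          · exact h3.2.symm
        · exact absurd rfl hw
      · grind
  calc deg (triNext G c) u ≤ _ := Finset.card_le_card hsub
    _ ≤ _ := Finset.card_union_le _ _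
    _ ≤ deg G u + deg G u := Nat.add_le_add_left Finset.card_image_le _
    _ = 2 * deg G u := by ring

lemma card_le_deg_add_missingPairs (G : SimpleGraph V) (u : V) :
    Fintype.card V ≤ deg G u + 1 + (missingPairs G).card := by
  have hsub : (Finset.univ : Finset V) ⊆ (nbr G u ∪ {u}) ∪
      (missingPairs G).image Prod.snd := by
    intro x _
    by_cases hx : x = u
    · simp [hx]
    · by_cases ha : G.Adj u x
      · simp [nbr, ha]
      · refine mem_union_right _ (mem_image.2 ⟨(u, x), ?_, rfl⟩)
        simp [missingPairs, ha, Ne.symm hx]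
  calc Fintype.card V ≤ _ := Finset.card_le_card hsub
    _ ≤ _ := Finset.card_union_le _ _
    _ ≤ _ := Nat.add_le_add (Finset.card_union_le _ _) Finset.card_image_le
    _ = _ := by simp [deg]

lemma missingPairs_card_le_triNext (G : SimpleGraph V) (c : V → V × V) :
    (missingPairs G).card ≤ (missingPairs (triNext G c)).card +
      ∑ v, if c v ∈ missingPairs G then 2 else 0 := by
  have hsub : missingPairs G ⊆ missingPairs (triNext G c) ∪
      (Finset.univ.filter fun v => c v ∈ missingPairs G).biUnion
        fun v => {c v, (c v).swap} := by
    rintro ⟨a, b⟩ hp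
    by_cases hq : (a, b) ∈ missingPairs (triNext G c)
    · exact mem_union_left _ hq
    · refine mem_union_right _ ?_
      simp only [missingPairs, mem_filter, mem_univ, true_and, triNext, SimpleGraph.sup_adj,
        SimpleGraph.fromEdgeSet_adj, Set.mem_ofPred_eq, mem_biUnion, mem_insert,
        mem_singleton] at hp hq ⊢
      obtain ⟨v, hv⟩ : ∃ v, s(a, b) = s((c v).1, (c v).2) := by
        by_contra hcon
        exact hq ⟨hp.1, by tauto⟩
      rcases hcv : c v with ⟨x, y⟩
      rw [hcv, Sym2.eq_iff] at hv
      refine ⟨v, ?_, ?_⟩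
      · rw [hcv]
        rcases hv with ⟨rfl, rfl⟩ | ⟨rfl, rfl⟩
        · exact hp
        · exact ⟨hp.1.symm, fun h => hp.2 h.symm⟩
      · rw [hcv]
        rcases hv with ⟨rfl, rfl⟩ | ⟨rfl, rfl⟩ <;> simp
  calc (missingPairs G).card ≤ _ := Finset.card_le_card hsub
    _ ≤ _ := Finset.card_union_le _ _
    _ ≤ _ := Nat.add_le_add_left (Finset.card_biUnion_le_card_mul _ _ 2
        fun v _ => Finset.card_le_two) _
    _ = _ := by rw [← Finset.sum_filter, Finset.sum_const, smul_eq_mul]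

/-- The chance that a vertex of degree at least `n / 4` selects a missing edge. -/
lemma sum_choiceWeight_missing_le (G : SimpleGraph V) (v : V) (hn : 0 < Fintype.card V)
    (hv : Fintype.card V ≤ 4 * deg G v) :
    ∑ p, choiceWeight G v p * (if p ∈ missingPairs G then 1 else 0) ≤
      (missingPairs G).card * (16 / (Fintype.card V : ℝ) ^ 2) := by
  simp only [mul_ite, mul_one, mul_zero]
  rw [← Finset.sum_filter, Finset.filter_mem_eq_inter, Finset.univ_inter, ← nsmul_eq_mul]
  refine Finset.sum_le_card_nsmul _ _ _ fun p _ => ?_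
  have hd : deg G v ≠ 0 := by omega
  have hnR : (0 : ℝ) < Fintype.card V := by exact_mod_cast hn
  have hvR : (Fintype.card V : ℝ) ≤ 4 * deg G v := by exact_mod_cast hv
  have hdR : (0 : ℝ) < deg G v := by linarith
  rw [choiceWeight, if_neg hd]
  split_ifs
  · rw [div_le_div_iff₀ (by positivity) (by positivity)]
    nlinarith
  · positivity

/-- Exponential moment bound for one round when every degree is at least `n / 4`. -/
lemma sum_triWeight_pow_missing_le (G : SimpleGraph V) (hn : 96 ≤ Fintype.card V)
    (hG : ∀ v, Fintype.card V ≤ 4 * deg G v) (g : ℝ) (hg : 1 / 2 ≤ g) (hg1 : g ≤ 1) :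
    ∑ c, triWeight G c * g ^ (missingPairs (triNext G c)).card ≤
      (g + 96 / (Fintype.card V : ℝ) * (1 - g)) ^ (missingPairs G).card := by
  set n : ℝ := (Fintype.card V : ℝ) with hndef
  set m := (missingPairs G).card with hm
  have hnR : (96 : ℝ) ≤ n := by rw [hndef]; exact_mod_cast hn
  have hg0 : 0 < g := by linarith
  set x : ℝ := g⁻¹ with hx
  have hx1 : 1 ≤ x := (one_le_inv₀ hg0).2 hg1
  have hx2 : x ≤ 2 := by
    rw [hx, inv_le_comm₀ hg0 (by norm_num)]
    linarith
  have hpt : ∀ c : V → V × V, g ^ (missingPairs (triNext G c)).card ≤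
      g ^ m * ∏ v, if c v ∈ missingPairs G then x ^ 2 else 1 := by
    intro c
    have h1 : (∏ v, if c v ∈ missingPairs G then x ^ 2 else 1) =
        x ^ (∑ v, if c v ∈ missingPairs G then 2 else 0) := by
      rw [← Finset.prod_pow_eq_pow_sum]
      refine Finset.prod_congr rfl fun v _ => ?_
      split_ifs <;> simp
    rw [h1, hx, inv_pow, ← div_eq_mul_inv, le_div_iff₀ (by positivity), ← pow_add]
    exact pow_le_pow_of_le_one hg0.le hg1 (missingPairs_card_le_triNext G c)
  have hfac : ∀ v, ∑ p, choiceWeight G v p * (if p ∈ missingPairs G then x ^ 2 else 1) ≤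
      Real.exp (3 * (x - 1) * (m * (16 / n ^ 2))) := by
    intro v
    have h1 : ∀ p, choiceWeight G v p * (if p ∈ missingPairs G then x ^ 2 else 1) =
        choiceWeight G v p +
          (x ^ 2 - 1) * (choiceWeight G v p * (if p ∈ missingPairs G then 1 else 0)) := by
      intro p
      split_ifs <;> ring
    simp only [h1]
    rw [Finset.sum_add_distrib, sum_choiceWeight, ← Finset.mul_sum]
    have h2 := sum_choiceWeight_missing_le G v (by omega) (hG v)
    have h3 : (x ^ 2 - 1) * ∑ p, choiceWeight G v p * (if p ∈ missingPairs G then 1 else 0) ≤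
        3 * (x - 1) * (m * (16 / n ^ 2)) := by
      refine (mul_le_mul_of_nonneg_left h2 (by nlinarith)).trans ?_
      exact mul_le_mul_of_nonneg_right (by nlinarith) (by positivity)
    linarith [Real.add_one_le_exp (3 * (x - 1) * (m * (16 / n ^ 2)))]
  have hexp : Real.exp (48 * (x - 1) / n) ≤ 1 + 96 / n * (x - 1) := by
    have hy0 : 0 ≤ 48 * (x - 1) / n := div_nonneg (by linarith) (by linarith)
    have hy1 : 48 * (x - 1) / n ≤ 1 / 2 := by
      rw [div_le_iff₀ (by linarith)]
      linarith
    have h4 := Real.abs_exp_sub_one_le (x := 48 * (x - 1) / n) (by rw [abs_of_nonneg hy0]; linarith)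
    rw [abs_of_nonneg hy0] at h4
    have h5 : 2 * (48 * (x - 1) / n) = 96 / n * (x - 1) := by ring
    linarith [le_abs_self (Real.exp (48 * (x - 1) / n) - 1)]
  calc ∑ c, triWeight G c * g ^ (missingPairs (triNext G c)).card
      ≤ ∑ c, triWeight G c * (g ^ m * ∏ v, if c v ∈ missingPairs G then x ^ 2 else 1) :=
        Finset.sum_le_sum fun c _ => mul_le_mul_of_nonneg_left (hpt c) (triWeight_nonneg G c)
    _ = g ^ m * ∏ v, ∑ p, choiceWeight G v p * (if p ∈ missingPairs G then x ^ 2 else 1) := by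
        rw [← sum_triWeight_mul_prod G fun _ p => if p ∈ missingPairs G then x ^ 2 else 1,
          Finset.mul_sum]
        exact Finset.sum_congr rfl fun c _ => by ring
    _ ≤ g ^ m * ∏ _v : V, Real.exp (3 * (x - 1) * (m * (16 / n ^ 2))) := by
        refine mul_le_mul_of_nonneg_left (Finset.prod_le_prod (fun v _ => ?_)
          fun v _ => hfac v) (by positivity)
        refine Finset.sum_nonneg fun p _ => mul_nonneg (choiceWeight_nonneg G v p) ?_
        split_ifs <;> positivity
    _ = g ^ m * Real.exp (48 * (x - 1) / n) ^ m := by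
        rw [Finset.prod_const, Finset.card_univ, ← Real.exp_nat_mul, ← Real.exp_nat_mul]
        congr 2
        rw [← hndef]
        field_simp
        ring
    _ ≤ g ^ m * (1 + 96 / n * (x - 1)) ^ m := by gcongr
    _ = (g + 96 / n * (1 - g)) ^ m := by
        rw [← mul_pow]
        congr 1
        rw [hx]
        field_simp

/-- The potential controlling completion within `r` rounds, for a base sequence `g`. -/
noncomputable def triPotential (g : ℕ → ℝ) (r : ℕ) (G : SimpleGraph V) : ℝ :=
  if ∀ v, Fintype.card V ≤ 4 * deg G v then g r ^ (missingPairs G).card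
    else g r ^ ((Fintype.card V - 1) / 2)

lemma sum_triStep_mul_triPotential_le (hn : 96 ≤ Fintype.card V) (g : ℕ → ℝ)
    (hg : ∀ r, 1 / 2 ≤ g r) (hg1 : ∀ r, g r ≤ 1)
    (hrec : ∀ r, g (r + 1) = g r + 96 / (Fintype.card V : ℝ) * (1 - g r))
    (r : ℕ) (G : SimpleGraph V) :
    ∑ G', triStep G G' * triPotential g r G' ≤ triPotential g (r + 1) G := by
  rw [sum_triStep_mul]
  have hg0 : 0 ≤ g r := by linarith [hg r]
  by_cases hG : ∀ v, Fintype.card V ≤ 4 * deg G v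
  · rw [triPotential, if_pos hG, hrec]
    refine le_trans (le_of_eq ?_) (sum_triWeight_pow_missing_le G hn hG (g r) (hg r) (hg1 r))
    refine Finset.sum_congr rfl fun c _ => ?_
    rw [triPotential, if_pos]
    intro v
    have hle : deg G v ≤ deg (triNext G c) v := by
      refine Finset.card_le_card fun x hx => ?_
      simp only [nbr, mem_filter, mem_univ, true_and] at hx ⊢
      exact Or.inl hx
    have := hG v
    omega
  · rw [triPotential, if_neg hG]
    push Not at hG
    obtain ⟨u, hu⟩ := hG
    have hstep : ∀ c, triWeight G c * triPotential g r (triNext G c) ≤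
        triWeight G c * g (r + 1) ^ ((Fintype.card V - 1) / 2) := by
      intro c
      by_cases hc : triWeight G c = 0
      · simp [hc]
      refine mul_le_mul_of_nonneg_left ?_ (triWeight_nonneg G c)
      have hmono : g r ≤ g (r + 1) := by
        rw [hrec]
        have : 0 ≤ 96 / (Fintype.card V : ℝ) * (1 - g r) :=
          mul_nonneg (by positivity) (by linarith [hg1 r])
        linarith
      refine le_trans ?_ (pow_le_pow_left₀ hg0 hmono _)
      unfold triPotential
      split_ifs
      · refine pow_le_pow_of_le_one hg0 (hg1 r) ?_
        have := deg_triNext_le G c hc u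
        have := card_le_deg_add_missingPairs (triNext G c) u
        omega
      · exact le_rfl
    refine (Finset.sum_le_sum fun c _ => hstep c).trans (le_of_eq ?_)
    rw [← Finset.sum_mul, sum_triWeight, one_mul]

lemma trajProb_triStep_le (Φ : ℕ → SimpleGraph V → ℝ) (hnn : ∀ G, 0 ≤ Φ 0 G)
    (htop : 1 ≤ Φ 0 ⊤) (hΦ : ∀ r G, ∑ G', triStep G G' * Φ r G' ≤ Φ (r + 1) G)
    (T : ℕ) (G0 : SimpleGraph V) :
    trajProb triStep G0 T (fun g => ∃ t ≤ T, g t = (⊤ : SimpleGraph V)) ≤ Φ T G0 :=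
  (trajProb_hit_top_le _ triStep_nonneg le_of_triStep_ne_zero G0 T).trans
    (sum_traj_le_of_supermartingale _ _ triStep_nonneg Φ hnn htop hΦ T G0)

lemma trajProb_triStep_le_one (T : ℕ) (G0 : SimpleGraph V) :
    trajProb triStep G0 T (fun g => ∃ t ≤ T, g t = (⊤ : SimpleGraph V)) ≤ 1 := by
  refine trajProb_triStep_le (fun _ _ => 1) (fun _ => zero_le_one) le_rfl (fun r G => ?_) T G0
  rw [sum_triStep_mul]
  simp [sum_triWeight]

lemma trajProb_triStep_le_pow (hn : 96 ≤ Fintype.card V) (T : ℕ) (G0 : SimpleGraph V) :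
    trajProb triStep G0 T (fun g => ∃ t ≤ T, g t = (⊤ : SimpleGraph V)) ≤
      (1 - (1 - 96 / (Fintype.card V : ℝ)) ^ T / 2) ^
        min (missingPairs G0).card ((Fintype.card V - 1) / 2) := by
  have hnR : (96 : ℝ) ≤ Fintype.card V := by exact_mod_cast hn
  have hp : 96 / (Fintype.card V : ℝ) ≤ 1 := by
    rw [div_le_one (by linarith)]
    exact hnR
  have hp0 : 0 ≤ 96 / (Fintype.card V : ℝ) := by positivity
  set g : ℕ → ℝ := fun r => 1 - (1 - 96 / (Fintype.card V : ℝ)) ^ r / 2 with hgdef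
  have hg : ∀ r, 1 / 2 ≤ g r := fun r => by
    have := pow_le_one₀ (n := r) (sub_nonneg.2 hp) (by linarith)
    simp only [hgdef]
    linarith
  have hg1 : ∀ r, g r ≤ 1 := fun r => by
    have := pow_nonneg (sub_nonneg.2 hp) r
    simp only [hgdef]
    linarith
  have hrec : ∀ r, g (r + 1) = g r + 96 / (Fintype.card V : ℝ) * (1 - g r) := fun r => by
    simp only [hgdef, pow_succ]
    ring
  have hg0 : ∀ r, 0 ≤ g r := fun r => by linarith [hg r]
  refine (trajProb_triStep_le (triPotential g) (fun G => ?_) ?_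
    (sum_triStep_mul_triPotential_le hn g hg hg1 hrec) T G0).trans ?_
  · unfold triPotential
    split_ifs <;> exact pow_nonneg (hg0 0) _
  · have hdeg : ∀ v, deg (⊤ : SimpleGraph V) v = Fintype.card V - 1 := fun v => by
      have : nbr (⊤ : SimpleGraph V) v = Finset.univ.erase v := by
        ext x
        simp [nbr, eq_comm]
      rw [deg, this, Finset.card_erase_of_mem (mem_univ v), Finset.card_univ]
    rw [triPotential, if_pos (fun v => by rw [hdeg]; omega)]
    have : missingPairs (⊤ : SimpleGraph V) = ∅ := by
      ext p
      simp [missingPairs]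
    simp [this]
  · unfold triPotential
    split_ifs
    · exact pow_le_pow_of_le_one (hg0 T) (hg1 T) (min_le_left _ _)
    · exact pow_le_pow_of_le_one (hg0 T) (hg1 T) (min_le_right _ _)

lemma le_card_missingPairs (G : SimpleGraph V) (k : ℕ)
    (h : (Finset.univ.filter (fun e : Sym2 V => e ∈ G.edgeSet)).card + k =
      Nat.choose (Fintype.card V) 2) : k ≤ (missingPairs G).card := by
  have h1 : (Finset.univ.filter fun e : Sym2 V => ¬ e.IsDiag).card =
      Nat.choose (Fintype.card V) 2 := by
    rw [← Sym2.card_subtype_not_diag, Fintype.card_subtype]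
  have hsub : (Finset.univ.filter fun e : Sym2 V => ¬ e.IsDiag) ⊆
      (Finset.univ.filter (fun e : Sym2 V => e ∈ G.edgeSet)) ∪
        (missingPairs G).image fun p => s(p.1, p.2) := by
    intro e he
    induction e with
    | h a b =>
      by_cases hab : G.Adj a b
      · exact mem_union_left _ (by simpa using hab)
      · refine mem_union_right _ (mem_image.2 ⟨(a, b), ?_, rfl⟩)
        simp only [mem_filter, mem_univ, true_and, Sym2.mk_isDiag_iff] at he
        simp [missingPairs, he, hab]
  have h2 := (Finset.card_le_card hsub).trans (Finset.card_union_le _ _)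
  have h3 : ((missingPairs G).image fun p => s(p.1, p.2)).card ≤ (missingPairs G).card :=
    Finset.card_image_le
  omega

end Triangulation

/-- A decay estimate for the coupon-collector type bound with `k ≤ n²` items. -/
lemma one_sub_pow_pow_le (n k T m : ℕ) (hn : 192 ≤ n) (hk : 2 ≤ k) (hkn : k ≤ n ^ 2)
    (hT : (T : ℝ) ≤ 1 / 1536 * n * Real.log k) (hm : min k ((n - 1) / 2) ≤ m) :
    (1 - (1 - 96 / (n : ℝ)) ^ T / 2) ^ m ≤
      Real.exp 64 * Real.exp (-(k : ℝ) ^ ((1 : ℝ) / 4)) := by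
  have hnR : (192 : ℝ) ≤ n := by exact_mod_cast hn
  have hkR : (2 : ℝ) ≤ k := by exact_mod_cast hk
  have hk0 : (0 : ℝ) < k := by linarith
  set p : ℝ := 96 / (n : ℝ) with hp
  have hp0 : 0 ≤ p := by positivity
  have hp1 : p ≤ 1 / 2 := by
    rw [hp, div_le_iff₀ (by linarith)]
    linarith
  set y : ℝ := (k : ℝ) ^ ((1 : ℝ) / 8) with hy
  have hy0 : 0 < y := Real.rpow_pos_of_pos hk0 _
  have hpow : ∀ j : ℕ, y ^ j = (k : ℝ) ^ ((j : ℝ) / 8) := fun j => by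
    rw [hy, ← Real.rpow_natCast, ← Real.rpow_mul hk0.le]
    congr 1
    ring
  have hy2 : (k : ℝ) ^ ((1 : ℝ) / 4) = y ^ 2 := by
    rw [hpow]
    norm_num
  have hy8 : (k : ℝ) = y ^ 8 := by
    rw [hpow]
    norm_num
  have hy1 : 1 ≤ y := Real.one_le_rpow (by linarith) (by norm_num)
  have hq : Real.exp (-(2 * p)) ≤ 1 - p := by
    rw [Real.exp_neg]
    refine inv_le_of_inv_le₀ (by linarith) ?_
    have h1 := Real.add_one_le_exp (2 * p)
    refine le_trans ?_ h1
    rw [inv_le_iff_one_le_mul₀ (by linarith)]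
    nlinarith
  have hqT : y⁻¹ ≤ (1 - p) ^ T := by
    refine le_trans ?_ (pow_le_pow_left₀ (Real.exp_pos _).le hq T)
    rw [← Real.exp_nat_mul, hy, Real.rpow_def_of_pos hk0, ← Real.exp_neg]
    refine Real.exp_le_exp.2 ?_
    have h1 : (T : ℝ) * (2 * p) ≤ 1 / 1536 * n * Real.log k * (2 * p) :=
      mul_le_mul_of_nonneg_right hT (by positivity)
    have h2 : 1 / 1536 * n * Real.log k * (2 * p) = Real.log k * (1 / 8) := by
      rw [hp]
      field_simp
      ring
    linarith
  have hmR : y ^ 4 / 4 ≤ m := by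
    have hy4n : y ^ 4 ≤ n := by
      have : (y ^ 4) ^ 2 ≤ (n : ℝ) ^ 2 := by
        rw [← pow_mul, ← hy8]
        exact_mod_cast hkn
      exact le_of_sq_le_sq this (by positivity)
    rcases min_le_iff.1 hm with h | h
    · have h' : (k : ℝ) ≤ m := by exact_mod_cast h
      have : y ^ 4 ≤ y ^ 8 := pow_le_pow_right₀ hy1 (by norm_num)
      nlinarith [pow_pos hy0 4]
    · have h' : n ≤ 4 * m := by omega
      have h'' : (n : ℝ) ≤ 4 * m := by exact_mod_cast h'
      linarith
  have hbase : 1 - (1 - p) ^ T / 2 ≤ Real.exp (-(y⁻¹ / 2)) := by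
    have := Real.add_one_le_exp (-(y⁻¹ / 2))
    linarith
  have hbase0 : 0 ≤ 1 - (1 - p) ^ T / 2 := by
    have := pow_le_one₀ (n := T) (a := 1 - p) (by linarith) (by linarith)
    linarith
  refine (pow_le_pow_left₀ hbase0 hbase m).trans ?_
  rw [← Real.exp_nat_mul, ← Real.exp_add, hy2]
  refine Real.exp_le_exp.2 ?_
  have h1 : y ^ 3 / 8 ≤ m * (y⁻¹ / 2) := by
    calc y ^ 3 / 8 = y ^ 4 / 4 * (y⁻¹ / 2) := by
          field_simp
          norm_num
      _ ≤ _ := mul_le_mul_of_nonneg_right hmR (by positivity)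
  have h2 : y ^ 2 ≤ 64 + y ^ 3 / 8 := by
    rcases le_total y 8 with h | h
    · nlinarith [pow_pos hy0 3]
    · nlinarith [pow_pos hy0 2]
  linarith

/-- There are constants `c > 0` and `c' > 0` such that the following
holds.  Let `G₀` be a connected simple graph on `n ≥ 2` vertices whose edge set has
`k ≥ 2` fewer edges than the complete graph on the same vertex set.  Then the
probability that the triangulation process started at `G₀` reaches the complete graph
within `⌊c·n·ln k⌋` rounds is at most `c'·exp(−k^(1/4))`. -/
theorem triangulation_lower_bound :
    ∃ c : ℝ, 0 < c ∧ ∃ c' : ℝ, 0 < c' ∧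
      ∀ (V : Type) [Fintype V] [DecidableEq V] (n : ℕ), 2 ≤ n → Fintype.card V = n →
        ∀ (G0 : SimpleGraph V), G0.Connected →
          ∀ k : ℕ, 2 ≤ k →
            (Finset.univ.filter (fun e : Sym2 V => e ∈ G0.edgeSet)).card + k =
              Nat.choose n 2 →
          ∀ T : ℕ, T = ⌊c * n * Real.log k⌋₊ →
            trajProb triStep G0 T (fun g => ∃ t ≤ T, g t = (⊤ : SimpleGraph V)) ≤
              c' * Real.exp (-(k : ℝ) ^ ((1 : ℝ) / 4)) := by
  refine ⟨1 / 1536, by norm_num, Real.exp 64, Real.exp_pos _, ?_⟩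
  intro V _ _ n hn hcard G0 _ k hk hE T hT
  subst hcard
  have hkn : k ≤ Fintype.card V ^ 2 :=
    (Nat.le_of_add_left_le hE.le).trans (Nat.choose_le_pow _ _)
  have hlog : 0 ≤ Real.log k := Real.log_natCast_nonneg k
  by_cases hbig : 192 ≤ Fintype.card V
  · have hTR : (T : ℝ) ≤ 1 / 1536 * (Fintype.card V : ℝ) * Real.log k := by
      rw [hT]
      exact Nat.floor_le (by positivity)
    refine (trajProb_triStep_le_pow (by omega) T G0).trans
      (one_sub_pow_pow_le (Fintype.card V) k T _ hbig hk hkn hTR ?_)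
    exact min_le_min_right _ (le_card_missingPairs G0 k hE)
  · refine (trajProb_triStep_le_one T G0).trans ?_
    rw [← Real.exp_add]
    refine Real.one_le_exp ?_
    have h1 : (k : ℝ) ≤ 64 ^ 4 := by
      have : k ≤ 192 ^ 2 := hkn.trans (Nat.pow_le_pow_left (by omega) 2)
      have : (k : ℝ) ≤ 192 ^ 2 := by exact_mod_cast this
      linarith
    have h2 : (k : ℝ) ^ ((1 : ℝ) / 4) ≤ 64 := by
      calc (k : ℝ) ^ ((1 : ℝ) / 4) ≤ ((64 : ℝ) ^ (4 : ℕ)) ^ ((1 : ℝ) / 4) :=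
            Real.rpow_le_rpow (by positivity) h1 (by norm_num)
        _ = 64 := by
            rw [← Real.rpow_natCast, ← Real.rpow_mul (by norm_num)]
            norm_num
    linarith
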